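/- In the per-step LAZOb setup, let A^s = A ∩ (−A) be the largest symmetric subset of A, and define the bias term b(u) = (d/(2δ))·(f_t(x_t + δu) − 2f_{t−1}(w_{t−1}) + f_t(x_t − δu))·u·1_{A∖A^s}(u). Then E_u[‖b(u)‖] ≤ (DηdL/δ + dL)·σ(A∖A^s). -/

import Mathlib

open MeasureTheory Pointwise

/-- The uniform probability measure on the closed unit ball of `ℝ^d`. -/
noncomputable def ballUniform (d : ℕ) : Measure (EuclideanSpace ℝ (Fin d)) :=
  (volume (Metric.closedBall (0 : EuclideanSpace ℝ (Fin d)) 1))⁻¹ •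
    volume.restrict (Metric.closedBall (0 : EuclideanSpace ℝ (Fin d)) 1)

/-- The uniform (rotation-invariant) probability measure on the unit sphere of `ℝ^d`,
realized as the pushforward of the uniform measure on the unit ball under the radial
projection `v ↦ v / ‖v‖`. -/
noncomputable def sphereUniform (d : ℕ) : Measure (EuclideanSpace ℝ (Fin d)) :=
  Measure.map (fun v => ‖v‖⁻¹ • v) (ballUniform d)

/-- The smoothed version `f_δ(x) = E_{v ~ uniform ball} [f (x + δ v)]`. -/
noncomputable def smoothed (d : ℕ) (f : EuclideanSpace ℝ (Fin d) → ℝ) (δ : ℝ)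
    (x : EuclideanSpace ℝ (Fin d)) : ℝ :=
  ∫ v, f (x + δ • v) ∂(ballUniform d)

/-- The asymmetric part `A ∖ A^s` of a set, where `A^s = A ∩ (−A)` is the largest
symmetric subset of `A`. -/
def asymPart {d : ℕ} (A : Set (EuclideanSpace ℝ (Fin d))) : Set (EuclideanSpace ℝ (Fin d)) :=
  A \ (A ∩ -A)

instance isFiniteMeasure_ballUniform (d : ℕ) : IsFiniteMeasure (ballUniform d) := by
  refine ⟨?_⟩
  simp only [ballUniform, Measure.smul_apply, Measure.restrict_apply_univ, smul_eq_mul]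
  exact (ENNReal.inv_mul_le_one _).trans_lt ENNReal.one_lt_top

instance isFiniteMeasure_sphereUniform (d : ℕ) : IsFiniteMeasure (sphereUniform d) := by
  unfold sphereUniform
  infer_instance

/-- The radial projection lands in the closed unit ball. -/
theorem ae_norm_le_one_sphereUniform (d : ℕ) : ∀ᵐ u ∂(sphereUniform d), ‖u‖ ≤ 1 := by
  have hm : Measurable fun v : EuclideanSpace ℝ (Fin d) => ‖v‖⁻¹ • v := by fun_prop
  have hs : MeasurableSet {u : EuclideanSpace ℝ (Fin d) | ‖u‖ ≤ 1} :=
    measurableSet_le measurable_norm measurable_const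
  rw [sphereUniform, ae_map_iff hm.aemeasurable hs]
  refine Filter.Eventually.of_forall fun v => ?_
  rw [norm_smul, norm_inv, norm_norm]
  exact inv_mul_le_one

theorem MeasurableSet.asymPart {d : ℕ} {A : Set (EuclideanSpace ℝ (Fin d))}
    (hA : MeasurableSet A) : MeasurableSet (asymPart A) :=
  hA.diff (hA.inter hA.neg)

/-- Pointwise bound on a symmetrized two-point estimator of an `L`-Lipschitz function with
baseline `c`, at a direction where the baseline is `R`-accurate. -/
theorem norm_two_point_le {E : Type*} [NormedAddCommGroup E] [NormedSpace ℝ E]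
    {f : E → ℝ} {L δ R c k : ℝ} (hδ : 0 < δ) (hL : 0 ≤ L) (hk : 0 ≤ k)
    (hf : ∀ x y, |f x - f y| ≤ L * ‖x - y‖) {x u : E} (hu : ‖u‖ ≤ 1)
    (hR : |f (x + δ • u) - c| ≤ R) :
    ‖(k / (2 * δ) * (f (x + δ • u) - 2 * c + f (x - δ • u))) • u‖ ≤
      R * k / δ + k * L := by
  have hlip : |f (x + δ • u) - f (x - δ • u)| ≤ 2 * δ * L := by
    have hnorm : ‖x + δ • u - (x - δ • u)‖ ≤ 2 * δ := by
      have : x + δ • u - (x - δ • u) = (2 * δ) • u := by module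
      rw [this, norm_smul, Real.norm_of_nonneg (by positivity)]
      exact mul_le_of_le_one_right (by positivity) hu
    calc _ ≤ L * ‖x + δ • u - (x - δ • u)‖ := hf _ _
      _ ≤ L * (2 * δ) := by gcongr
      _ = 2 * δ * L := by ring
  have habs : |f (x + δ • u) - 2 * c + f (x - δ • u)| ≤ 2 * R + 2 * δ * L := by
    rw [abs_le] at *
    constructor <;> linarith
  calc _ ≤ |k / (2 * δ) * (f (x + δ • u) - 2 * c + f (x - δ • u))| := by
        rw [norm_smul, Real.norm_eq_abs]
        exact mul_le_of_le_one_right (abs_nonneg _) hu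
    _ = k / (2 * δ) * |f (x + δ • u) - 2 * c + f (x - δ • u)| := by
        rw [abs_mul, abs_of_nonneg (by positivity)]
    _ ≤ k / (2 * δ) * (2 * R + 2 * δ * L) := by gcongr
    _ = R * k / δ + k * L := by field_simp

/-- Bound on the bias of the (per-step) LAZOb gradient estimator:
`E_u[‖b(u)‖] ≤ (Dηd L/δ + dL)·σ(A ∖ A^s)`. -/
theorem stmt10 (d : ℕ) (hd : 1 ≤ d) (δ η D L : ℝ) (hδ : 0 < δ) (hη : 0 < η) (hD : 0 < D)
    (hL : 0 ≤ L)
    (ft ftm : EuclideanSpace ℝ (Fin d) → ℝ)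
    (hft : ∀ x y, |ft x - ft y| ≤ L * ‖x - y‖)
    (hftm : ∀ x y, |ftm x - ftm y| ≤ L * ‖x - y‖)
    (xt xtm utm : EuclideanSpace ℝ (Fin d)) (hutm : ‖utm‖ = 1) :
    (∫ u, ‖(asymPart
          {w : EuclideanSpace ℝ (Fin d) |
            |ft (xt + δ • w) - ftm (xtm + δ • utm)| ≤ D * η * L}).indicator
        (fun u => ((d : ℝ) / (2 * δ) *
          (ft (xt + δ • u) - 2 * ftm (xtm + δ • utm) + ft (xt - δ • u))) • u) u‖
        ∂(sphereUniform d)) ≤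
      (D * η * d * L / δ + d * L) *
        (sphereUniform d (asymPart
          {w : EuclideanSpace ℝ (Fin d) |
            |ft (xt + δ • w) - ftm (xtm + δ • utm)| ≤ D * η * L})).toReal := by
  have hcont : Continuous ft :=
    (LipschitzWith.of_dist_le_mul (K := L.toNNReal) fun x y => by
      simpa [Real.dist_eq, dist_eq_norm, hL] using hft x y).continuous
  set A : Set (EuclideanSpace ℝ (Fin d)) :=
    {w | |ft (xt + δ • w) - ftm (xtm + δ • utm)| ≤ D * η * L}
  have hAm : MeasurableSet A :=
    (isClosed_le (by fun_prop) continuous_const).measurableSet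
  have hB : MeasurableSet (asymPart A) := hAm.asymPart
  calc _ ≤ ∫ u, (asymPart A).indicator (fun _ => D * η * d * L / δ + d * L) u
        ∂(sphereUniform d) := by
        refine integral_mono_of_nonneg (Filter.Eventually.of_forall fun u => norm_nonneg _)
          ((integrable_const _).indicator hB) ?_
        filter_upwards [ae_norm_le_one_sphereUniform d] with u hu
        by_cases hmem : u ∈ asymPart A
        · simp only [Set.indicator_of_mem hmem]
          refine (norm_two_point_le hδ hL (Nat.cast_nonneg d) hft hu hmem.1).trans_eq ?_
          ring
        · simp [Set.indicator_of_notMem hmem]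
    _ = _ := by
        rw [integral_indicator_const _ hB, smul_eq_mul, mul_comm, Measure.real]
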